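/- Let P be a probability measure on (Ω,M), g ∈ M_b(Ω), and f ∈ F₁(a,b) admissible with a ≥ 0 and f strictly convex on (a,b) (so that f* is continuously differentiable on ℝ). Then there exists ν* ∈ ℝ such that dQ* := (f*)'(g − ν*) dP defines a probability measure, and sup over probability measures Q on (Ω,M) of {E_Q[g] − D_f(Q‖P)} = E_{Q*}[g] − D_f(Q*‖P) = ν* + E_P[f*(g − ν*)] = Λ_f^P[g]. Moreover, Q* is the unique maximizer of Q ↦ E_Q[g] − D_f(Q‖P) over probability measures. -/

import Mathlib

open MeasureTheory Filter Set Topology ENNReal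
open scoped Classical

noncomputable section

/-- The set of bounded measurable real-valued functions on `Ω`. -/
def Mb (Ω : Type*) [MeasurableSpace Ω] : Set (Ω → ℝ) :=
  {g | Measurable g ∧ ∃ C : ℝ, ∀ x, |g x| ≤ C}

/-- The set of bounded continuous real-valued functions on `S`. -/
def Cb (S : Type*) [TopologicalSpace S] : Set (S → ℝ) :=
  {g | Continuous g ∧ ∃ C : ℝ, ∀ x, |g x| ≤ C}

/-- The positive part of an extended real number, as an element of `ℝ≥0∞`. -/
def posE (x : EReal) : ℝ≥0∞ := if x = ⊤ then ⊤ else ENNReal.ofReal x.toReal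

/-- The extended-real-valued integral of an `EReal`-valued function, defined as the
difference of the lower integrals of the positive and negative parts, with the
convention `∞ - ∞ = -∞`. -/
def eIntegral {Ω : Type*} [MeasurableSpace Ω] (P : Measure Ω) (h : Ω → EReal) : EReal :=
  ((∫⁻ x, posE (h x) ∂P : ℝ≥0∞) : EReal) - ((∫⁻ x, posE (-(h x)) ∂P : ℝ≥0∞) : EReal)

/-- The Legendre transform `f*(y) = sup_x {x*y - f(x)}` of `f : ℝ → (-∞,∞]`. -/
def fstar (f : ℝ → EReal) (y : ℝ) : EReal := ⨆ x : ℝ, (((x * y : ℝ) : EReal) - f x)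

/-- `f : ℝ → (-∞,∞]` is (the convex LSC extension of) an element of `F₁(a,b)`:
convex, lower semicontinuous, never `-∞`, finite exactly on the interval `(a,b)`
(with `+∞` strictly outside `[a,b]`), and `f(1) = 0` with `a < 1 < b`. -/
structure IsF1 (a b : EReal) (f : ℝ → EReal) : Prop where
  a_lt_one : a < ((1 : ℝ) : EReal)
  one_lt_b : ((1 : ℝ) : EReal) < b
  convex : ∀ x y t : ℝ, 0 < t → t < 1 →
    f (t * x + (1 - t) * y) ≤ ((t : ℝ) : EReal) * f x + (((1 - t : ℝ)) : EReal) * f y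
  lsc : LowerSemicontinuous f
  ne_bot : ∀ x, f x ≠ ⊥
  finite_on : ∀ x : ℝ, a < (x : EReal) → (x : EReal) < b → f x ≠ ⊤
  top_outside : ∀ x : ℝ, ((x : EReal) < a ∨ b < (x : EReal)) → f x = ⊤
  at_one : f 1 = 0

/-- `Λ_f^P[g] = inf_{ν ∈ ℝ} {ν + E_P[f*(g - ν)]}`. -/
def LambdaF {Ω : Type*} [MeasurableSpace Ω] (f : ℝ → EReal) (P : Measure Ω) (g : Ω → ℝ) :
    EReal :=
  ⨅ ν : ℝ, ((ν : EReal) + eIntegral P (fun x => fstar f (g x - ν)))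

/-- The classical `f`-divergence `D_f(Q‖P) = E_P[f(dQ/dP)]` if `Q ≪ P`, else `∞`. -/
def fDivE {Ω : Type*} [MeasurableSpace Ω] (f : ℝ → EReal) (Q P : Measure Ω) : EReal :=
  if Q ≪ P then eIntegral P (fun x => f ((Q.rnDeriv P x).toReal)) else ⊤

/-- The `(f,Γ)`-divergence `D_f^Γ(Q‖P) = sup_{g ∈ Γ} {E_Q[g] - Λ_f^P[g]}`. -/
def fGammaDiv {Ω : Type*} [MeasurableSpace Ω] (f : ℝ → EReal) (Γ : Set (Ω → ℝ))
    (Q P : Measure Ω) : EReal :=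
  ⨆ g ∈ Γ, (((∫ x, g x ∂Q : ℝ) : EReal) - LambdaF f P g)

/-- The `Γ`-IPM `W^Γ(Q,P) = sup_{g ∈ Γ} {E_Q[g] - E_P[g]}`. -/
def ipmW {Ω : Type*} [MeasurableSpace Ω] (Γ : Set (Ω → ℝ)) (Q P : Measure Ω) : EReal :=
  ⨆ g ∈ Γ, (((∫ x, g x ∂Q : ℝ) : EReal) - ((∫ x, g x ∂P : ℝ) : EReal))

end

/-- `f` is admissible: `f*` is finite everywhere and `lim_{y → -∞} f*(y) < ∞`. -/
def AdmissibleF (f : ℝ → EReal) : Prop :=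
  (∀ y : ℝ, fstar f y ≠ ⊤) ∧ ∃ M : ℝ, ∀ᶠ y in Filter.atBot, fstar f y ≤ (M : EReal)

/-- `f` is strictly convex on the interval `(a,b)` (with `a, b ∈ [-∞,∞]`). -/
def StrictConvexOnAB (a b : EReal) (f : ℝ → EReal) : Prop :=
  ∀ x y t : ℝ, a < (x : EReal) → (x : EReal) < b → a < (y : EReal) → (y : EReal) < b →
    x ≠ y → 0 < t → t < 1 →
    f (t * x + (1 - t) * y) < ((t : ℝ) : EReal) * f x + (((1 - t : ℝ)) : EReal) * f y

lemma aux_top {a b : EReal} {f : ℝ → EReal} (hf : IsF1 a b f) (ha : (0 : EReal) ≤ a)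
    {x : ℝ} (hx : f x ≠ ⊤) : 0 ≤ x ∧ a ≤ (x : EReal) ∧ (x : EReal) ≤ b := by
  have h1 : a ≤ (x : EReal) := by
    by_contra h
    exact hx (hf.top_outside x (Or.inl (not_le.mp h)))
  have h2 : (x : EReal) ≤ b := by
    by_contra h
    exact hx (hf.top_outside x (Or.inr (not_le.mp h)))
  exact ⟨by exact_mod_cast ha.trans h1, h1, h2⟩

lemma aux_fstar {a b : EReal} {f : ℝ → EReal} (hf : IsF1 a b f) (hfa : AdmissibleF f) (y : ℝ) :
    fstar f y = (((fstar f y).toReal : ℝ) : EReal) := by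
  refine (EReal.coe_toReal (hfa.1 y) ?_).symm
  have h : ((1 * y : ℝ) : EReal) - f 1 ≤ fstar f y :=
    le_iSup (fun x : ℝ => (((x * y : ℝ) : EReal) - f x)) 1
  rw [hf.at_one, sub_zero] at h
  intro h'
  rw [h'] at h
  exact EReal.coe_ne_bot _ (le_bot_iff.mp h)

lemma aux_FY {a b : EReal} {f : ℝ → EReal} (hf : IsF1 a b f) (hfa : AdmissibleF f) (x y : ℝ) :
    ((x * y - (fstar f y).toReal : ℝ) : EReal) ≤ f x := by
  have h : ((x * y : ℝ) : EReal) - f x ≤ fstar f y :=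
    le_iSup (fun x : ℝ => (((x * y : ℝ) : EReal) - f x)) x
  rw [aux_fstar hf hfa y] at h
  induction hh : f x with
  | bot => exact absurd hh (hf.ne_bot x)
  | top => exact le_top
  | coe r =>
    rw [hh] at h
    norm_cast at h ⊢
    linarith

lemma aux_exists {a b : EReal} {f : ℝ → EReal} (hf : IsF1 a b f) (hfa : AdmissibleF f)
    (ha : (0 : EReal) ≤ a) (y : ℝ) :
    ∃ x : ℝ, f x = ((x * y - (fstar f y).toReal : ℝ) : EReal) := by
  set R : ℝ := max 1 ((fstar f (y + 1)).toReal - y) with hR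
  have hlsc : LowerSemicontinuous (fun x : ℝ => f x + ((-(x * y) : ℝ) : EReal)) := by
    refine hf.lsc.add' ?_ ?_
    · exact (continuous_coe_real_ereal.comp (by fun_prop)).lowerSemicontinuous
    · intro x
      exact EReal.continuousAt_add (Or.inr (EReal.coe_ne_bot _)) (Or.inr (EReal.coe_ne_top _))
  obtain ⟨x0, hx0, hmin⟩ := (hlsc.lowerSemicontinuousOn (Icc 0 R)).exists_isMinOn
    ⟨1, by simp [hR]⟩ isCompact_Icc
  have h1 : f x0 + ((-(x0 * y) : ℝ) : EReal) ≤ ((- y : ℝ) : EReal) := by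
    have := hmin (show (1 : ℝ) ∈ Icc 0 R by simp [hR])
    simpa [hf.at_one] using this
  obtain ⟨r, hr⟩ : ∃ r : ℝ, f x0 = r := by
    induction hh : f x0 with
    | bot => exact absurd hh (hf.ne_bot x0)
    | top => rw [hh, EReal.top_add_coe] at h1; exact absurd (top_le_iff.mp h1) (EReal.coe_ne_top _)
    | coe r => exact ⟨r, rfl⟩
  refine ⟨x0, ?_⟩
  rw [hr] at h1
  have h1' : r + -(x0 * y) ≤ -y := by exact_mod_cast h1
  have key : fstar f y ≤ ((x0 * y - r : ℝ) : EReal) := by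
    refine iSup_le fun x => ?_
    induction hh : f x with
    | bot => exact absurd hh (hf.ne_bot x)
    | top => simp
    | coe s =>
      have hx : 0 ≤ x := (aux_top hf ha (x := x) (by rw [hh]; exact EReal.coe_ne_top _)).1
      norm_cast
      by_cases hxR : x ≤ R
      · have := hmin (show x ∈ Icc 0 R from ⟨hx, hxR⟩)
        simp only [mem_ofPred_eq, hh, hr] at this
        norm_cast at this
        linarith
      · have h2 := aux_FY hf hfa x (y + 1)
        rw [hh] at h2
        norm_cast at h2
        have h3 : (fstar f (y + 1)).toReal - y ≤ R := le_max_right _ _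
        push Not at hxR
        nlinarith
  have key2 := aux_FY hf hfa x0 y
  rw [aux_fstar hf hfa y] at key
  rw [hr] at key2 ⊢
  norm_cast at key key2 ⊢
  linarith

lemma aux_unique {a b : EReal} {f : ℝ → EReal} (hf : IsF1 a b f) (hfa : AdmissibleF f)
    (ha : (0 : EReal) ≤ a) (hsc : StrictConvexOnAB a b f) (y x1 x2 : ℝ)
    (h1 : f x1 = ((x1 * y - (fstar f y).toReal : ℝ) : EReal))
    (h2 : f x2 = ((x2 * y - (fstar f y).toReal : ℝ) : EReal)) : ¬ x1 < x2 := by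
  intro hlt
  set F := (fstar f y).toReal with hF
  have hseg : ∀ t : ℝ, 0 < t → t < 1 →
      f (t * x1 + (1 - t) * x2) = (((t * x1 + (1 - t) * x2) * y - F : ℝ) : EReal) := by
    intro t ht0 ht1
    refine le_antisymm ?_ (aux_FY hf hfa _ y)
    refine (hf.convex x1 x2 t ht0 ht1).trans (le_of_eq ?_)
    rw [h1, h2]
    norm_cast
    ring
  have ha1 := (aux_top hf ha (x := x1) (by rw [h1]; exact EReal.coe_ne_top _)).2.1
  have hb2 := (aux_top hf ha (x := x2) (by rw [h2]; exact EReal.coe_ne_top _)).2.2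
  have hin : ∀ t : ℝ, 0 < t → t < 1 → a < ((t * x1 + (1 - t) * x2 : ℝ) : EReal) ∧
      ((t * x1 + (1 - t) * x2 : ℝ) : EReal) < b := by
    intro t ht0 ht1
    constructor
    · refine lt_of_le_of_lt ha1 ?_
      norm_cast
      nlinarith
    · refine lt_of_lt_of_le ?_ hb2
      norm_cast
      nlinarith
  have A := hin (1/3) (by norm_num) (by norm_num)
  have B := hin (2/3) (by norm_num) (by norm_num)
  have hs := hsc _ _ (1/2) A.1 A.2 B.1 B.2 (by intro h; linarith) (by norm_num) (by norm_num)
  rw [hseg (1/3) (by norm_num) (by norm_num), hseg (2/3) (by norm_num) (by norm_num)] at hs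
  have hs' := lt_of_le_of_lt (aux_FY hf hfa _ y) hs
  rw [← hF] at hs'
  norm_cast at hs'
  linarith

lemma aux_X {a b : EReal} {f : ℝ → EReal} (hf : IsF1 a b f) (hfa : AdmissibleF f)
    (ha : (0 : EReal) ≤ a) (hsc : StrictConvexOnAB a b f) :
    ∃ X : ℝ → ℝ, Continuous X ∧ Monotone X ∧ (∀ y, 0 ≤ X y) ∧
      (∀ y, HasDerivAt (fun y => (fstar f y).toReal) (X y) y) ∧
      (∀ y, f (X y) = ((X y * y - (fstar f y).toReal : ℝ) : EReal)) ∧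
      (∀ x y, f x = ((x * y - (fstar f y).toReal : ℝ) : EReal) → x = X y) ∧
      (∃ y0, X y0 ≤ 1) ∧ (∃ y1, 1 ≤ X y1) := by
  choose X hX using aux_exists hf hfa ha
  have huniq : ∀ x y, f x = ((x * y - (fstar f y).toReal : ℝ) : EReal) → x = X y := by
    intro x y h
    exact le_antisymm (not_lt.mp (aux_unique hf hfa ha hsc y _ _ (hX y) h))
      (not_lt.mp (aux_unique hf hfa ha hsc y _ _ h (hX y)))
  set F : ℝ → ℝ := fun y => (fstar f y).toReal with hF
  have hX' : ∀ y, f (X y) = ((X y * y - F y : ℝ) : EReal) := hX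
  have hFY : ∀ x y, ((x * y - F y : ℝ) : EReal) ≤ f x := fun x y => aux_FY hf hfa x y
  have hpos : ∀ y, 0 ≤ X y := fun y =>
    (aux_top hf ha (x := X y) (by rw [hX]; exact EReal.coe_ne_top _)).1
  have hsub : ∀ y z, F y + X y * (z - y) ≤ F z := by
    intro y z
    have := hFY (X y) z
    rw [hX' y] at this
    norm_cast at this
    linarith
  have hmono : Monotone X := by
    intro y z hyz
    rcases eq_or_lt_of_le hyz with rfl | hlt
    · exact le_rfl
    have h1 := hsub y z
    have h2 := hsub z y
    by_contra h
    push Not at h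
    nlinarith
  have hcont : Continuous X := by
    rw [continuous_iff_continuousAt]
    intro y
    refine (isCompact_Icc (a := X (y - 1)) (b := X (y + 1))).tendsto_nhds_of_unique_mapClusterPt
      (l := 𝓝 y) ?_ ?_
    · filter_upwards [Icc_mem_nhds (show y - 1 < y by linarith) (show y < y + 1 by linarith)]
        with z hz
      exact ⟨hmono hz.1, hmono hz.2⟩
    · intro L _ hL
      have hle : ∀ x' : ℝ, ∀ s : ℝ, f x' = s → f L ≤ ((L * y - x' * y + s : ℝ) : EReal) := by
        intro x' s hs
        have hcl : IsClosed {p : ℝ × ℝ | f p.2 ≤ ((p.2 * p.1 - x' * p.1 + s : ℝ) : EReal)} := by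
          have := hf.lsc.isClosed_epigraph
          exact this.preimage (f := fun p : ℝ × ℝ =>
            (p.2, ((p.2 * p.1 - x' * p.1 + s : ℝ) : EReal)))
            (by
              refine continuous_snd.prodMk (continuous_coe_real_ereal.comp (by fun_prop)))
        obtain ⟨U, hU, hUL⟩ := mapClusterPt_iff_ultrafilter.mp hL
        have ht : Tendsto (fun z => (z, X z)) U (𝓝 (y, L)) :=
          Tendsto.prodMk_nhds (tendsto_id.mono_left hU) hUL
        refine hcl.mem_of_tendsto ht (Eventually.of_forall fun z => ?_)
        change f (X z) ≤ ((X z * z - x' * z + s : ℝ) : EReal)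
        have h1 := hFY x' z
        rw [hs] at h1
        rw [hX' z]
        norm_cast at h1 ⊢
        linarith
      obtain ⟨r, hr⟩ : ∃ r : ℝ, f L = r := by
        have h0 := hle 1 0 (by simpa using hf.at_one)
        exact ⟨_, (EReal.coe_toReal (ne_top_of_le_ne_top (EReal.coe_ne_top _) h0) (hf.ne_bot L)).symm⟩
      apply huniq
      refine le_antisymm ?_ (hFY L y)
      refine (hle (X y) _ (hX y)).trans (le_of_eq ?_)
      congr 1
      ring
  have hder : ∀ y, HasDerivAt F (X y) y := by
    intro y
    rw [hasDerivAt_iff_isLittleO, Asymptotics.isLittleO_iff]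
    intro c hc
    have hc' := (hcont.tendsto y).eventually (Metric.ball_mem_nhds (X y) hc)
    filter_upwards [hc'] with z hz
    have h1 := hsub y z
    have h2 := hsub z y
    have hz' : |X z - X y| < c := by simpa [Real.dist_eq] using hz
    have h3 : |F z - F y - (z - y) * X y| ≤ |(X z - X y) * (z - y)| := by
      rw [abs_of_nonneg (by linarith)]
      refine le_trans ?_ (le_abs_self _)
      linarith
    rw [abs_mul] at h3
    simp only [smul_eq_mul, Real.norm_eq_abs]
    exact h3.trans (by gcongr)
  have hup : ∀ y, F y ≤ X y * y + F 0 := by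
    intro y
    have := hFY (X y) 0
    rw [hX' y] at this
    norm_cast at this
    linarith
  refine ⟨X, hcont, hmono, hpos, hder, hX, huniq, ?_, ?_⟩
  · obtain ⟨x0, hx0a, hx0⟩ := EReal.lt_iff_exists_real_btwn.mp hf.a_lt_one
    have hx1 : x0 < 1 := by exact_mod_cast hx0
    have hfin := hf.finite_on x0 hx0a (lt_trans hx0 hf.one_lt_b)
    obtain ⟨r, hr⟩ : ∃ r : ℝ, f x0 = r := ⟨_, (EReal.coe_toReal hfin (hf.ne_bot _)).symm⟩
    by_contra! hcon
    set y := -(|F 0 + r| + 1) / (1 - x0) with hy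
    have hy0 : y * (1 - x0) = -(|F 0 + r| + 1) := by
      rw [hy]; field_simp [show (1 - x0) ≠ 0 by linarith]
    have hyn : y ≤ 0 := by
      by_contra! h
      have := mul_pos h (show 0 < 1 - x0 by linarith)
      have := abs_nonneg (F 0 + r)
      linarith
    have h1 := hFY x0 y
    rw [hr] at h1
    norm_cast at h1
    have h2 := hup y
    have h3 := hcon y
    have h4 := le_abs_self (F 0 + r)
    nlinarith
  · obtain ⟨x0, hx0, hx0b⟩ := EReal.lt_iff_exists_real_btwn.mp hf.one_lt_b
    have hx1 : 1 < x0 := by exact_mod_cast hx0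
    have hfin := hf.finite_on x0 (lt_trans hf.a_lt_one hx0) hx0b
    obtain ⟨r, hr⟩ : ∃ r : ℝ, f x0 = r := ⟨_, (EReal.coe_toReal hfin (hf.ne_bot _)).symm⟩
    by_contra! hcon
    set y := (|F 0 + r| + 1) / (x0 - 1) with hy
    have hy0 : y * (x0 - 1) = (|F 0 + r| + 1) := by
      rw [hy]; field_simp [show (x0 - 1) ≠ 0 by linarith]
    have hyn : 0 ≤ y := by
      have : 0 < x0 - 1 := by linarith
      positivity
    have h1 := hFY x0 y
    rw [hr] at h1
    norm_cast at h1
    have h2 := hup y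
    have h3 := hcon y
    have h4 := le_abs_self (F 0 + r)
    nlinarith

lemma posE_coe (r : ℝ) : posE (r : EReal) = ENNReal.ofReal r := by
  simp [posE]

lemma measurable_posE : Measurable posE := by
  unfold posE
  exact Measurable.ite (measurableSet_eq) measurable_const
    (measurable_ereal_toReal.ennreal_ofReal)

lemma eIntegral_congr {Ω : Type*} [MeasurableSpace Ω] {P : Measure Ω} {h k : Ω → EReal}
    (hk : h =ᵐ[P] k) : eIntegral P h = eIntegral P k := by
  unfold eIntegral
  have h1 : ∫⁻ x, posE (h x) ∂P = ∫⁻ x, posE (k x) ∂P := lintegral_congr_ae (hk.fun_comp posE)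
  have h2 : ∫⁻ x, posE (-(h x)) ∂P = ∫⁻ x, posE (-(k x)) ∂P :=
    lintegral_congr_ae (hk.fun_comp fun x => posE (-x))
  rw [h1, h2]

lemma eIntegral_coe {Ω : Type*} [MeasurableSpace Ω] {P : Measure Ω} {u : Ω → ℝ}
    (hu : Integrable u P) : eIntegral P (fun x => (u x : EReal)) = ((∫ x, u x ∂P : ℝ) : EReal) := by
  unfold eIntegral
  simp_rw [← EReal.coe_neg, posE_coe]
  rw [integral_eq_lintegral_pos_part_sub_lintegral_neg_part hu]
  have h1 : ∫⁻ x, ENNReal.ofReal (u x) ∂P ≠ ⊤ := hu.lintegral_lt_top.ne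
  have h2 : ∫⁻ x, ENNReal.ofReal (-u x) ∂P ≠ ⊤ := hu.neg.lintegral_lt_top.ne
  rw [EReal.coe_sub, EReal.coe_ennreal_toReal h1, EReal.coe_ennreal_toReal h2]

lemma eIntegral_dichotomy {Ω : Type*} [MeasurableSpace Ω] {P : Measure Ω} {h : Ω → EReal}
    (hm : Measurable h) (hb : ∀ x, h x ≠ ⊥) {k : Ω → ℝ} (hk : Integrable k P)
    (hkh : ∀ x, (k x : EReal) ≤ h x) :
    eIntegral P h = ⊤ ∨ ∃ u : Ω → ℝ, Integrable u P ∧ (∀ᵐ x ∂P, h x = (u x : EReal)) := by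
  by_cases htop : ∫⁻ x, posE (h x) ∂P = ⊤
  · left
    have hN : ∫⁻ x, posE (-(h x)) ∂P ≠ ⊤ := by
      refine ne_top_of_le_ne_top (hk.neg.lintegral_lt_top.ne) (lintegral_mono fun x => ?_)
      have := hkh x
      induction hh : h x with
      | bot => exact absurd hh (hb x)
      | top => simp [posE]
      | coe r =>
        rw [hh] at this
        norm_cast at this
        rw [← EReal.coe_neg, posE_coe]
        exact ENNReal.ofReal_le_ofReal (by simpa using this)
    unfold eIntegral
    rw [htop, ← EReal.coe_ennreal_toReal hN]
    simp
  · right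
    refine ⟨fun x => (h x).toReal, ?_, ?_⟩
    · have hI := integrable_toReal_of_lintegral_ne_top
        ((measurable_posE.comp hm).aemeasurable) htop
      refine Integrable.mono' (hI.add hk.abs) (hm.ereal_toReal.aestronglyMeasurable) ?_
      refine Eventually.of_forall fun x => ?_
      have := hkh x
      simp only [Pi.add_apply, Function.comp, Real.norm_eq_abs]
      induction hh : h x with
      | bot => exact absurd hh (hb x)
      | top => simp [posE]
      | coe r =>
        rw [hh] at this
        norm_cast at this
        rw [posE_coe, EReal.toReal_coe, ENNReal.toReal_ofReal']
        have h1 := neg_abs_le (k x)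
        have h2 := le_max_left r 0
        have h3 := le_max_right r 0
        have h4 := abs_nonneg (k x)
        exact abs_le.mpr ⟨by linarith, by linarith⟩
    · filter_upwards [ae_lt_top (measurable_posE.comp hm) htop] with x hx
      refine (EReal.coe_toReal ?_ (hb x)).symm
      intro hh
      simp [posE, hh] at hx

lemma integrable_comp_bdd {Ω : Type*} [MeasurableSpace Ω] {P : Measure Ω} [IsFiniteMeasure P]
    {g : Ω → ℝ} (hg : g ∈ Mb Ω) {H : ℝ → ℝ} (hH : Continuous H) (ν : ℝ) :
    Integrable (fun x => H (g x - ν)) P := by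
  obtain ⟨hm, C, hC⟩ := hg
  obtain ⟨B, hB⟩ := (isCompact_Icc (a := -C - ν) (b := C - ν)).exists_bound_of_continuousOn
    hH.continuousOn
  refine Integrable.of_bound (hH.measurable.comp (hm.sub_const ν)).aestronglyMeasurable B ?_
  refine Eventually.of_forall fun x => hB _ ?_
  have := abs_le.mp (hC x)
  exact ⟨by linarith [this.1], by linarith [this.2]⟩

lemma aux_weak {Ω : Type*} [MeasurableSpace Ω]
    {a b : EReal} {f : ℝ → EReal} (hf : IsF1 a b f) (hfa : AdmissibleF f)
    (hFc : Continuous (fun y => (fstar f y).toReal))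
    (P : Measure Ω) [IsProbabilityMeasure P] (g : Ω → ℝ) (hg : g ∈ Mb Ω) (ν : ℝ)
    (Q : Measure Ω) [IsProbabilityMeasure Q] :
    (((∫ x, g x ∂Q : ℝ) : EReal) - fDivE f Q P
      ≤ ((ν + ∫ x, (fstar f (g x - ν)).toReal ∂P : ℝ) : EReal)) ∧
    (((∫ x, g x ∂Q : ℝ) : EReal) - fDivE f Q P
      = ((ν + ∫ x, (fstar f (g x - ν)).toReal ∂P : ℝ) : EReal) →
      Q ≪ P ∧ ∀ᵐ x ∂P, f ((Q.rnDeriv P x).toReal)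
        = (((Q.rnDeriv P x).toReal * (g x - ν) - (fstar f (g x - ν)).toReal : ℝ) : EReal)) := by
  have htopc : fDivE f Q P = ⊤ → (((∫ x, g x ∂Q : ℝ) : EReal) - fDivE f Q P
      ≤ ((ν + ∫ x, (fstar f (g x - ν)).toReal ∂P : ℝ) : EReal)) ∧
    (((∫ x, g x ∂Q : ℝ) : EReal) - fDivE f Q P
      = ((ν + ∫ x, (fstar f (g x - ν)).toReal ∂P : ℝ) : EReal) →
      Q ≪ P ∧ ∀ᵐ x ∂P, f ((Q.rnDeriv P x).toReal)
        = (((Q.rnDeriv P x).toReal * (g x - ν) - (fstar f (g x - ν)).toReal : ℝ) : EReal)) := by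
    intro h
    rw [h, EReal.sub_top]
    exact ⟨bot_le, fun h => absurd h.symm (EReal.coe_ne_bot _)⟩
  by_cases hac : Q ≪ P
  swap
  · exact htopc (by simp [fDivE, hac])
  have hD : fDivE f Q P = eIntegral P (fun x => f ((Q.rnDeriv P x).toReal)) := by
    simp [fDivE, hac]
  have hqm : Measurable (fun x => (Q.rnDeriv P x).toReal) :=
    (Measure.measurable_rnDeriv Q P).ennreal_toReal
  have hFi := integrable_comp_bdd (P := P) hg hFc ν
  have hqi : Integrable (fun x => (Q.rnDeriv P x).toReal) P := Measure.integrable_toReal_rnDeriv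
  have hgQ : Integrable g Q := by
    obtain ⟨hm, C, hC⟩ := hg
    exact Integrable.of_bound hm.aestronglyMeasurable C (Eventually.of_forall hC)
  have hqg : Integrable (fun x => (Q.rnDeriv P x).toReal * g x) P :=
    (integrable_toReal_rnDeriv_mul_iff hac).mpr hgQ
  have hqg' : Integrable (fun x => (Q.rnDeriv P x).toReal * (g x - ν)) P := by
    have := hqg.sub (hqi.mul_const ν)
    refine this.congr (Eventually.of_forall fun x => ?_)
    simp; ring
  have hi1 : ∫ x, (Q.rnDeriv P x).toReal * (g x - ν) ∂P = ∫ x, g x ∂Q - ν := by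
    have e1 : ∫ x, (Q.rnDeriv P x).toReal * g x ∂P = ∫ x, g x ∂Q :=
      integral_toReal_rnDeriv_mul hac
    have e2 : ∫ x, (Q.rnDeriv P x).toReal ∂P = 1 := by
      rw [Measure.integral_toReal_rnDeriv hac]; simp
    simp_rw [mul_sub]
    rw [integral_sub hqg (hqi.mul_const ν), e1, integral_mul_const, e2]
    ring
  rcases eIntegral_dichotomy (P := P) (hf.lsc.measurable.comp hqm) (fun x => hf.ne_bot _)
    (hqg'.sub hFi) (fun x => aux_FY hf hfa _ _) with h | ⟨u, hu, hue⟩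
  · exact htopc (hD.trans h)
  have hD2 : fDivE f Q P = ((∫ x, u x ∂P : ℝ) : EReal) := by
    rw [hD, ← eIntegral_coe hu]
    exact eIntegral_congr hue
  set w : Ω → ℝ := fun x => u x - ((Q.rnDeriv P x).toReal * (g x - ν)
    - (fstar f (g x - ν)).toReal) with hw
  have hwi : Integrable w P := hu.sub (hqg'.sub hFi)
  have hw0 : 0 ≤ᵐ[P] w := by
    filter_upwards [hue] with x hx
    have h1 := aux_FY hf hfa ((Q.rnDeriv P x).toReal) (g x - ν)
    simp only [Function.comp] at hx
    rw [hx] at h1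
    norm_cast at h1
    simp only [hw, Pi.zero_apply]
    linarith
  have hwint : ∫ x, w x ∂P = ∫ x, u x ∂P - (∫ x, g x ∂Q - ν
      - ∫ x, (fstar f (g x - ν)).toReal ∂P) := by
    have e1 := integral_sub hu (hqg'.sub hFi)
    have e2 := integral_sub hqg' hFi
    rw [hi1] at e2
    rw [← e2]
    exact e1
  rw [hD2]
  norm_cast
  constructor
  · have := integral_nonneg_of_ae hw0
    linarith
  · intro heq
    refine ⟨hac, ?_⟩
    have hz : ∫ x, w x ∂P = 0 := by linarith
    have hz' := (integral_eq_zero_iff_of_nonneg_ae hw0 hwi).mp hz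
    filter_upwards [hue, hz'] with x hx hx0
    simp only [Function.comp] at hx
    rw [hx]
    simp only [hw, Pi.zero_apply] at hx0
    congr 1
    linarith

/-- For admissible `f ∈ F₁(a,b)` with `a ≥ 0`, strictly convex on
`(a,b)`, and bounded measurable `g`, there is `ν* ∈ ℝ` such that
`dQ* = (f*)'(g - ν*) dP` is a probability measure which uniquely maximizes
`Q ↦ E_Q[g] - D_f(Q‖P)`, with optimal value `ν* + E_P[f*(g - ν*)] = Λ_f^P[g]`. -/
theorem stmt16 {Ω : Type*} [MeasurableSpace Ω]
    (a b : EReal) (f : ℝ → EReal) (hf : IsF1 a b f) (hfa : AdmissibleF f)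
    (ha : (0 : EReal) ≤ a) (hsc : StrictConvexOnAB a b f)
    (P : Measure Ω) [IsProbabilityMeasure P] (g : Ω → ℝ) (hg : g ∈ Mb Ω) :
    ∃ νs : ℝ,
      IsProbabilityMeasure
        (P.withDensity
          (fun x => ENNReal.ofReal (deriv (fun y => (fstar f y).toReal) (g x - νs))))
      ∧ (⨆ Q ∈ {Q : Measure Ω | IsProbabilityMeasure Q},
            (((∫ x, g x ∂Q : ℝ) : EReal) - fDivE f Q P))
          = ((∫ x, g x
                ∂(P.withDensity (fun x =>
                  ENNReal.ofReal (deriv (fun y => (fstar f y).toReal) (g x - νs)))) : ℝ)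
              : EReal)
            - fDivE f
                (P.withDensity (fun x =>
                  ENNReal.ofReal (deriv (fun y => (fstar f y).toReal) (g x - νs)))) P
      ∧ (⨆ Q ∈ {Q : Measure Ω | IsProbabilityMeasure Q},
            (((∫ x, g x ∂Q : ℝ) : EReal) - fDivE f Q P))
          = (νs : EReal) + eIntegral P (fun x => fstar f (g x - νs))
      ∧ (⨆ Q ∈ {Q : Measure Ω | IsProbabilityMeasure Q},
            (((∫ x, g x ∂Q : ℝ) : EReal) - fDivE f Q P))
          = LambdaF f P g
      ∧ (∀ Q : Measure Ω, IsProbabilityMeasure Q →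
          (((∫ x, g x ∂Q : ℝ) : EReal) - fDivE f Q P)
            = (⨆ Q' ∈ {Q' : Measure Ω | IsProbabilityMeasure Q'},
                (((∫ x, g x ∂Q' : ℝ) : EReal) - fDivE f Q' P)) →
          Q = P.withDensity
            (fun x => ENNReal.ofReal (deriv (fun y => (fstar f y).toReal) (g x - νs)))) := by
  obtain ⟨X, hXc, hXm, hX0, hder, hXf, hXu, ⟨y0, hy0⟩, ⟨y1, hy1⟩⟩ := aux_X hf hfa ha hsc
  have hFc : Continuous (fun y => (fstar f y).toReal) :=
    continuous_iff_continuousAt.mpr fun y => (hder y).continuousAt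
  have hderiv : deriv (fun y => (fstar f y).toReal) = X := funext fun y => (hder y).deriv
  rw [hderiv]
  have hgm := hg.1
  obtain ⟨C, hC⟩ := hg.2
  have hXi : ∀ ν, Integrable (fun x => X (g x - ν)) P := integrable_comp_bdd hg hXc
  have hIc : Continuous (fun ν => ∫ x, X (g x - ν) ∂P) := by
    rw [continuous_iff_continuousAt]
    intro ν
    refine continuousAt_of_dominated (bound := fun _ => X (C - ν + 1)) ?_ ?_ ?_ ?_
    · exact Eventually.of_forall fun ν => (hXi ν).aestronglyMeasurable
    · filter_upwards [Ioi_mem_nhds (show ν - 1 < ν by linarith)] with z hz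
      refine Eventually.of_forall fun x => ?_
      rw [Real.norm_eq_abs, abs_of_nonneg (hX0 _)]
      have := (abs_le.mp (hC x)).2
      have hz' : ν - 1 < z := hz
      exact hXm (by linarith)
    · exact integrable_const _
    · exact Eventually.of_forall fun x => (hXc.comp (by fun_prop)).continuousAt
  obtain ⟨νs, hνs⟩ : ∃ ν, ∫ x, X (g x - ν) ∂P = 1 := by
    refine mem_range_of_exists_le_of_exists_ge hIc ⟨C - y0, ?_⟩ ⟨-C - y1, ?_⟩
    · have : ∫ x, X (g x - (C - y0)) ∂P ≤ ∫ _, (1 : ℝ) ∂P := by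
        refine integral_mono (hXi _) (integrable_const _) fun x => ?_
        have := (abs_le.mp (hC x)).2
        exact (hXm (by linarith)).trans hy0
      simpa using this
    · have : ∫ _, (1 : ℝ) ∂P ≤ ∫ x, X (g x - (-C - y1)) ∂P := by
        refine integral_mono (integrable_const _) (hXi _) fun x => ?_
        have := (abs_le.mp (hC x)).1
        exact hy1.trans (hXm (by linarith))
      simpa using this
  set Qs : Measure Ω := P.withDensity (fun x => ENNReal.ofReal (X (g x - νs))) with hQs
  have hdm : Measurable (fun x => ENNReal.ofReal (X (g x - νs))) :=
    (hXc.measurable.comp (hgm.sub_const νs)).ennreal_ofReal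
  have hQp : IsProbabilityMeasure Qs := by
    constructor
    rw [hQs, withDensity_apply _ MeasurableSet.univ, Measure.restrict_univ,
      ← ofReal_integral_eq_lintegral_ofReal (hXi νs) (Eventually.of_forall fun x => hX0 _), hνs]
    simp
  have hFi := fun ν => integrable_comp_bdd (P := P) hg hFc ν
  have hval : ∀ ν : ℝ, (ν : EReal) + eIntegral P (fun x => fstar f (g x - ν))
      = ((ν + ∫ x, (fstar f (g x - ν)).toReal ∂P : ℝ) : EReal) := by
    intro ν
    rw [EReal.coe_add, ← eIntegral_coe (hFi ν)]
    congr 2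
    funext x
    exact aux_fstar hf hfa _
  have hweak := fun (ν : ℝ) (Q : Measure Ω) (hQ : IsProbabilityMeasure Q) =>
    aux_weak hf hfa hFc P g hg ν Q
  have hac : Qs ≪ P := withDensity_absolutelyContinuous _ _
  have hXgi : Integrable (fun x => X (g x - νs) * (g x - νs)) P :=
    integrable_comp_bdd (H := fun y => X y * y) hg (by fun_prop) νs
  have hopt : ((∫ x, g x ∂Qs : ℝ) : EReal) - fDivE f Qs P
      = ((νs + ∫ x, (fstar f (g x - νs)).toReal ∂P : ℝ) : EReal) := by
    have h1 : fDivE f Qs P = ((∫ x, (X (g x - νs) * (g x - νs)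
        - (fstar f (g x - νs)).toReal) ∂P : ℝ) : EReal) := by
      refine Eq.trans ?_ (eIntegral_coe (hXgi.sub (hFi νs)))
      simp only [fDivE, hac, if_true]
      apply eIntegral_congr
      filter_upwards [Measure.rnDeriv_withDensity P hdm] with x hx
      rw [hx, ENNReal.toReal_ofReal (hX0 _)]
      exact hXf _
    have h2 : ∫ x, g x ∂Qs = ∫ x, X (g x - νs) * (g x - νs) ∂P + νs := by
      rw [hQs, integral_withDensity_eq_integral_toReal_smul hdm
        (Eventually.of_forall fun x => ENNReal.ofReal_lt_top)]
      have e : ∀ x, (ENNReal.ofReal (X (g x - νs))).toReal • g x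
          = X (g x - νs) * (g x - νs) + X (g x - νs) * νs := by
        intro x
        rw [ENNReal.toReal_ofReal (hX0 _), smul_eq_mul]
        ring
      simp_rw [e]
      rw [integral_add hXgi ((hXi νs).mul_const νs), integral_mul_const, hνs, one_mul]
    rw [h1, h2, integral_sub hXgi (hFi νs)]
    norm_cast
    ring
  have hsup : (⨆ Q ∈ {Q : Measure Ω | IsProbabilityMeasure Q},
            (((∫ x, g x ∂Q : ℝ) : EReal) - fDivE f Q P))
      = ((νs + ∫ x, (fstar f (g x - νs)).toReal ∂P : ℝ) : EReal) := by
    refine le_antisymm (iSup₂_le fun Q hQ => (hweak νs Q hQ).1) ?_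
    rw [← hopt]
    exact le_iSup₂ (f := fun (Q : Measure Ω) (_ : Q ∈ {Q : Measure Ω | IsProbabilityMeasure Q}) =>
      (((∫ x, g x ∂Q : ℝ) : EReal) - fDivE f Q P)) Qs hQp
  refine ⟨νs, hQp, hsup.trans hopt.symm, hsup.trans (hval νs).symm, ?_, ?_⟩
  · rw [hsup]
    unfold LambdaF
    refine le_antisymm (le_iInf fun ν => ?_) ((iInf_le _ νs).trans (hval νs).le)
    rw [hval ν, ← hopt]
    exact (hweak ν Qs hQp).1
  · intro Q hQ heq
    rw [hsup] at heq
    obtain ⟨hQac, hae⟩ := (hweak νs Q hQ).2 heq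
    rw [← Measure.withDensity_rnDeriv_eq Q P hQac]
    refine withDensity_congr_ae ?_
    filter_upwards [hae, Measure.rnDeriv_lt_top Q P] with x hx hlt
    rw [← hXu _ _ hx, ENNReal.ofReal_toReal hlt.ne]
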